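/- Let r ≥ 3 be an odd integer and let k be an integer with 1 ≤ k ≤ 2r/3. Then every r-regular graph has a [k−1, k]-factor each of whose connected components is a regular graph. -/

import Mathlib

/-- A finite undirected multigraph without loops: `E` indexes the edges, and each
edge has an unordered pair of distinct endpoints (parallel edges are allowed). -/
structure Multigraph (V : Type*) (E : Type*) where
  ends : E → Sym2 V
  loopless : ∀ e, ¬ (ends e).IsDiag

namespace Multigraph

variable {V E : Type*}

/-- The edges incident with a vertex `v`. -/
def incidence (G : Multigraph V E) [Fintype E] [DecidableEq V] (v : V) : Finset E :=
  Finset.univ.filter fun e => v ∈ G.ends e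

/-- The degree of a vertex `v`. -/
def degree (G : Multigraph V E) [Fintype E] [DecidableEq V] (v : V) : ℕ :=
  (G.incidence v).card

/-- The degree of a vertex `v` in the spanning subgraph with edge set `F`. -/
def degIn (G : Multigraph V E) [Fintype E] [DecidableEq V] (F : Finset E) (v : V) : ℕ :=
  (F.filter fun e => v ∈ G.ends e).card

/-- The simple graph on `V` whose adjacencies are realised by the edges in `F`;
used to speak about reachability/connectivity in the subgraph with edge set `F`. -/
def supportGraph (G : Multigraph V E) (F : Set E) : SimpleGraph V where
  Adj v w := v ≠ w ∧ ∃ e ∈ F, G.ends e = s(v, w)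
  symm := by
    refine ⟨?_⟩
    rintro v w ⟨hvw, e, he, hee⟩
    refine ⟨hvw.symm, e, he, ?_⟩
    rwa [Sym2.eq_swap]
  loopless := by refine ⟨?_⟩; rintro v ⟨h, -⟩; exact h rfl

/-- A zero-sum flow: nonzero integer values on the edges summing to zero at
every vertex. -/
def IsZeroSumFlow (G : Multigraph V E) [Fintype E] [DecidableEq V] (f : E → ℤ) : Prop :=
  (∀ e, f e ≠ 0) ∧ ∀ v, ∑ e ∈ G.incidence v, f e = 0

/-- A zero-sum `k`-flow: a zero-sum flow with values in `{±1, …, ±(k-1)}`. -/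
def IsZeroSumKFlow (G : Multigraph V E) [Fintype E] [DecidableEq V] (k : ℕ) (f : E → ℤ) : Prop :=
  G.IsZeroSumFlow f ∧ ∀ e, |f e| ≤ (k : ℤ) - 1

end Multigraph

open Finset

/-- Tutte's theorem in terms of finsets: a graph of even order without a perfect matching has a
vertex set `U` and at least `#U + 2` disjoint odd sets of vertices, each joined only to `U`. -/
theorem SimpleGraph.exists_odd_family_of_no_perfectMatching
    {A : Type*} [Fintype A] [DecidableEq A]
    (Γ : SimpleGraph A) (heven : Even (Fintype.card A))
    (hno : ¬ ∃ M : Γ.Subgraph, M.IsPerfectMatching) :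
    ∃ (U : Finset A) (𝒞 : Finset (Finset A)), #U + 2 ≤ #𝒞 ∧
      (∀ C ∈ 𝒞, Odd #C ∧ Disjoint C U ∧ ∀ x ∈ C, ∀ y, Γ.Adj x y → y ∉ C → y ∈ U) ∧
      ∀ C ∈ 𝒞, ∀ C' ∈ 𝒞, C ≠ C' → Disjoint C C' := by
  classical
  rw [SimpleGraph.tutte] at hno
  push Not at hno
  obtain ⟨u, hu⟩ := hno
  unfold SimpleGraph.IsTutteViolator at hu
  set H := ((⊤ : Γ.Subgraph).deleteVerts u).coe with hH
  have hverts : ∀ x, x ∈ ((⊤ : Γ.Subgraph).deleteVerts u).verts ↔ x ∉ u := by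
    intro x; simp
  have hpar := SimpleGraph.odd_ncard_oddComponents H
  have hcard : Nat.card ((⊤ : Γ.Subgraph).deleteVerts u).verts + u.ncard = Fintype.card A := by
    have h1 : ((⊤ : Γ.Subgraph).deleteVerts u).verts = uᶜ := by ext x; simp
    rw [h1, Nat.card_coe_set_eq, add_comm, Set.ncard_add_ncard_compl, Nat.card_eq_fintype_card]
  let toSet : H.ConnectedComponent → Finset A := fun K => (Subtype.val '' K.supp).toFinset
  have hmem : ∀ K x, x ∈ toSet K ↔ ∃ h : x ∉ u, H.connectedComponentMk ⟨x, (hverts x).2 h⟩ = K := by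
    intro K x
    simp only [toSet, Set.mem_toFinset, Set.mem_image, SimpleGraph.ConnectedComponent.mem_supp_iff]
    constructor
    · rintro ⟨y, hy, rfl⟩; exact ⟨(hverts _).1 y.2, hy⟩
    · rintro ⟨h, hy⟩; exact ⟨_, hy, rfl⟩
  have hcardK : ∀ K, #(toSet K) = K.supp.ncard := by
    intro K
    rw [← Set.ncard_eq_toFinset_card', Set.ncard_image_of_injective _ Subtype.val_injective]
  have hdisj : ∀ K K', K ≠ K' → Disjoint (toSet K) (toSet K') := by
    intro K K' hne
    rw [Finset.disjoint_left]
    intro x hx hx'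
    obtain ⟨_, h1⟩ := (hmem _ _).1 hx
    obtain ⟨_, h2⟩ := (hmem _ _).1 hx'
    exact hne (h1.symm.trans h2)
  have hne : ∀ K, (toSet K).Nonempty := by
    intro K
    obtain ⟨x, hx⟩ := K.nonempty_supp
    exact ⟨x, (hmem _ _).2 ⟨(hverts _).1 x.2, hx⟩⟩
  have hinj : Function.Injective toSet := by
    intro K K' h
    by_contra hK
    have := hdisj K K' hK
    rw [h, disjoint_self] at this
    exact (hne K').ne_empty this
  refine ⟨u.toFinset, H.oddComponents.toFinset.image toSet, ?_, ?_, ?_⟩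
  · rw [Finset.card_image_of_injective _ hinj, ← Set.ncard_eq_toFinset_card',
      ← Set.ncard_eq_toFinset_card']
    rw [← hcard] at heven
    generalize Nat.card ((⊤ : Γ.Subgraph).deleteVerts u).verts = a at *
    generalize H.oddComponents.ncard = b at *
    rw [Nat.odd_iff, Nat.odd_iff] at hpar
    rw [Nat.even_iff] at heven
    omega
  · intro C hC
    obtain ⟨K, hK, rfl⟩ := Finset.mem_image.1 hC
    refine ⟨?_, ?_, ?_⟩
    · rw [hcardK]; simpa [SimpleGraph.oddComponents] using hK
    · rw [Finset.disjoint_left]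
      intro x hx
      obtain ⟨h, _⟩ := (hmem _ _).1 hx
      simpa using h
    · intro x hx y hxy hy
      obtain ⟨h, hK⟩ := (hmem _ _).1 hx
      by_contra hyu
      rw [Set.mem_toFinset] at hyu
      refine hy ((hmem _ _).2 ⟨hyu, ?_⟩)
      rw [← hK]
      apply SimpleGraph.ConnectedComponent.sound
      apply SimpleGraph.Adj.reachable
      simp [H, hxy.symm, h, hyu]
  · intro C hC C' hC' h
    obtain ⟨K, hK, rfl⟩ := Finset.mem_image.1 hC
    obtain ⟨K', hK', rfl⟩ := Finset.mem_image.1 hC'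
    exact hdisj _ _ (fun e => h (by rw [e]))

/-- If the edges of a graph of even order without a perfect matching carry weights of total at most
`r` at each vertex, then some family of at least two pairwise separated odd sets has total cut
weight at most `r` times the size of the family minus `2 * r`. -/
theorem SimpleGraph.exists_odd_family_of_weight {A : Type*} [Fintype A] [DecidableEq A]
    (Γ : SimpleGraph A) (heven : Even (Fintype.card A))
    (hno : ¬ ∃ M : Γ.Subgraph, M.IsPerfectMatching) (w : A → A → ℕ) (r : ℕ)
    (hw : ∀ x y, w x y ≠ 0 → Γ.Adj x y) (hwr : ∀ y, ∑ x, w x y ≤ r) :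
    ∃ 𝒞 : Finset (Finset A), 2 ≤ #𝒞 ∧ (∑ C ∈ 𝒞, ∑ x ∈ C, ∑ y ∈ Cᶜ, w x y) + 2 * r ≤ #𝒞 * r ∧
      (∀ C ∈ 𝒞, Odd #C) ∧
      ∀ C ∈ 𝒞, ∀ C' ∈ 𝒞, C ≠ C' → ∀ x ∈ C, ∀ y ∈ C', x ≠ y ∧ ¬ Γ.Adj x y := by
  obtain ⟨U, 𝒞, hU, hC, hdisj⟩ := Γ.exists_odd_family_of_no_perfectMatching heven hno
  refine ⟨𝒞, by omega, ?_, fun C h => (hC C h).1, ?_⟩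
  · have h1 : ∀ C ∈ 𝒞, ∑ x ∈ C, ∑ y ∈ Cᶜ, w x y ≤ ∑ x ∈ C, ∑ y ∈ U, w x y := by
      intro C h
      refine Finset.sum_le_sum fun x hx => Finset.sum_le_sum_of_ne_zero fun y hy hne => ?_
      exact (hC C h).2.2 x hx y (hw _ _ hne) (by simpa using hy)
    have h2 : ∑ C ∈ 𝒞, ∑ x ∈ C, ∑ y ∈ U, w x y ≤ #U * r := by
      rw [← Finset.sum_biUnion (fun C h C' h' hne => hdisj C h C' h' hne), Finset.sum_comm]
      refine Finset.sum_le_card_nsmul _ _ _ fun y _ => ?_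
      exact (Finset.sum_le_sum_of_subset (Finset.subset_univ _)).trans (hwr y)
    have h3 := Finset.sum_le_sum h1
    have h4 : (#U + 2) * r ≤ #𝒞 * r := Nat.mul_le_mul_right _ hU
    linarith
  · intro C h C' h' hne x hx y hy
    have hd := hdisj C h C' h' hne
    refine ⟨fun e => Finset.disjoint_left.1 hd hx (e ▸ hy), fun hadj => ?_⟩
    have := (hC C h).2.2 x hx y hadj (fun h => Finset.disjoint_left.1 hd h hy)
    exact Finset.disjoint_left.1 (hC C' h').2.1 hy this

theorem even_card_of_involutive_of_ne {P : Type*} {m : P → P} (hm : Function.Involutive m)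
    (s : Finset P) (hs : ∀ x ∈ s, m x ∈ s) (hne : ∀ x ∈ s, m x ≠ x) : Even #s := by
  rw [← ZMod.natCast_eq_zero_iff_even, Finset.card_eq_sum_ones, Nat.cast_sum]
  refine Finset.sum_involution (fun x _ => m x) (fun x _ => by decide) (fun x hx _ => hne x hx)
    hs (fun x _ => hm x)

section
variable {X P : Type*} [Fintype X] [DecidableEq X] [Fintype P] [DecidableEq P]
  {a : P → X} {m : P → P} {c d : ℕ} {I : Finset P} {j : X → ℕ}

/-! A graph is described here by its half-edges `P`: the half-edge `x` is at the vertex `a x`, and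
its other half is `m x`, where `m x = x` if the edge leaves the vertex set `X`. -/

variable (a m c d) in
/-- The weight, with respect to `gadgetWeight`, of the cut around a set of gadget vertices
consisting of the half-edges in `I` and, for each `v`, of `j v` of the `c` cores at `v`. -/
def cutWeight (I : Finset P) (j : X → ℕ) : ℕ :=
  d * #{x ∈ I | m x ∉ I} +
    ∑ v, (#{x ∈ I | a x = v} * (c - j v) + j v * #{x ∈ Iᶜ | a x = v})

omit [Fintype X] in
theorem card_fiber_inter_add (hdeg : ∀ v, #{x | a x = v} = d + c) (v : X) :
    #{x ∈ I | a x = v} + #{x ∈ Iᶜ | a x = v} = d + c := by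
  rw [← hdeg v, ← Finset.card_union_of_disjoint, ← Finset.filter_union, Finset.union_compl]
  exact Finset.disjoint_filter_filter disjoint_compl_right

theorem cutWeight_eq_of_forall (W : Finset X) (hW : ∀ v, j v = if v ∈ W then c else 0) :
    cutWeight a m c d I j =
      d * #{x ∈ I | m x ∉ I} + c * #{x | ¬ (x ∈ I ↔ a x ∈ W)} := by
  unfold cutWeight
  congr 1
  rw [Finset.card_eq_sum_card_fiberwise (f := a) (t := univ) (fun _ _ => by simp), Finset.mul_sum]
  refine Finset.sum_congr rfl fun v _ => ?_
  rw [hW v]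
  by_cases hv : v ∈ W
  · simp only [hv, if_true, Nat.sub_self, mul_zero, zero_add]
    congr 2
    ext x; simp only [mem_filter, mem_compl, mem_univ, true_and]
    constructor
    · rintro ⟨h, rfl⟩; simp [h, hv]
    · rintro ⟨h, rfl⟩; simp_all
  · simp only [hv, if_false, Nat.sub_zero, zero_mul, add_zero]
    rw [mul_comm]
    congr 2
    ext x; simp only [mem_filter, mem_univ, true_and]
    constructor
    · rintro ⟨h, rfl⟩; simp [h, hv]
    · rintro ⟨h, rfl⟩; simp_all

/-- In an odd-regular graph without bridges, a cut of the gadget around an odd set has weight at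
least the degree `d + c`. -/
theorem le_cutWeight (hm : Function.Involutive m) (hdeg : ∀ v, #{x | a x = v} = d + c)
    (hodd : Odd (d + c)) (hd1 : Odd d → d + c ≤ 3 * d) (hd2 : Even d → d + c ≤ 3 * c)
    (hconn : ∀ W : Finset X, W.Nonempty → W ≠ univ → 2 ≤ #{x | a x ∈ W ∧ a (m x) ∉ W})
    (hj : ∀ v, j v ≤ c) (hjc : ∃ v, j v ≠ c) (hI : ∀ x ∈ I, m x ≠ x) (hpar : Odd (#I + ∑ v, j v)) :
    d + c ≤ cutWeight a m c d I j := by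
  by_cases h : ∃ v, 0 < j v ∧ j v < c
  · obtain ⟨v, hv0, hvc⟩ := h
    have h1 := card_fiber_inter_add (I := I) hdeg v
    have h2 : #{x ∈ I | a x = v} * 1 ≤ #{x ∈ I | a x = v} * (c - j v) :=
      Nat.mul_le_mul_left _ (by omega)
    have h3 : 1 * #{x ∈ Iᶜ | a x = v} ≤ j v * #{x ∈ Iᶜ | a x = v} := Nat.mul_le_mul_right _ hv0
    have h4 := Finset.single_le_sum
      (f := fun v => #{x ∈ I | a x = v} * (c - j v) + j v * #{x ∈ Iᶜ | a x = v})
      (fun _ _ => Nat.zero_le _) (mem_univ v)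
    unfold cutWeight
    omega
  · push Not at h
    set W : Finset X := {v | j v = c} with hWdef
    have hW : ∀ v, j v = if v ∈ W then c else 0 := by
      intro v
      have := h v; have := hj v
      simp only [hWdef, mem_filter, mem_univ, true_and]
      split_ifs <;> omega
    have hWne : W ≠ univ := by
      rintro hWu
      obtain ⟨v, hv⟩ := hjc
      have : v ∈ W := hWu ▸ mem_univ v
      simp [hWdef] at this; exact hv this
    rw [cutWeight_eq_of_forall W hW]
    have hsum : ∑ v, j v = c * #W := by
      simp only [hW]; simp [mul_comm]
    rw [hsum] at hpar
    set s := #{x ∈ I | m x ∉ I} with hs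
    set t := #{x | ¬ (x ∈ I ↔ a x ∈ W)} with ht
    have hB : #{x | a x ∈ W} = (d + c) * #W := by
      rw [Finset.card_eq_sum_card_fiberwise (f := a) (t := W) (fun x hx => by simpa using hx)]
      rw [Finset.sum_congr rfl (g := fun _ => d + c), Finset.sum_const, smul_eq_mul, mul_comm]
      intro v hv
      rw [← hdeg v]
      congr 1
      ext x; simp only [mem_filter, mem_univ, true_and]
      constructor
      · exact fun h => h.2
      · rintro rfl; exact ⟨hv, rfl⟩
    have hIs : Even (#I + s) := by
      have h1 : #{x ∈ I | m x ∈ I} + s = #I := Finset.card_filter_add_card_filter_not _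
      have h2 : Even #{x ∈ I | m x ∈ I} := by
        refine even_card_of_involutive_of_ne hm _ ?_ ?_
        · intro x hx
          simp only [mem_filter] at hx ⊢
          exact ⟨hx.2, by rw [hm x]; exact hx.1⟩
        · intro x hx
          exact hI x (mem_filter.1 hx).1
      rw [← h1]
      rw [Nat.even_iff] at *; omega
    have hIt : Even (#I + t + (d + c) * #W) := by
      rw [← hB]
      have h1 : #{x ∈ I | a x ∈ W} + #{x ∈ I | a x ∉ W} = #I :=
        Finset.card_filter_add_card_filter_not _
      have h2 : #{x ∈ ({x | a x ∈ W} : Finset P) | x ∈ I} +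
          #{x ∈ ({x | a x ∈ W} : Finset P) | x ∉ I} = #{x | a x ∈ W} :=
        Finset.card_filter_add_card_filter_not _
      have h3 : ({x ∈ ({x | a x ∈ W} : Finset P) | x ∈ I}) = {x ∈ I | a x ∈ W} := by
        ext x; simp [and_comm]
      have h4 : t = #{x ∈ I | a x ∉ W} + #{x ∈ ({x | a x ∈ W} : Finset P) | x ∉ I} := by
        rw [ht, ← Finset.card_union_of_disjoint]
        · congr 1
          ext x; simp only [mem_filter, mem_union, mem_univ, true_and]; tauto
        · rw [Finset.disjoint_left]
          intro x hx hx'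
          simp only [mem_filter, mem_univ, true_and] at hx hx'
          exact hx.2 hx'.1
      rw [h3] at h2
      rw [Nat.even_iff]; omega
    have hK : W.Nonempty → 2 ≤ #{x | a x ∈ W ∧ a (m x) ∉ W} := fun hn => hconn W hn hWne
    have hWpos : Odd #W → W.Nonempty := fun ho => Finset.card_pos.1 ho.pos
    rcases Nat.eq_zero_or_pos s with hs0 | hs0
    · have hclosed : ∀ x ∈ I, m x ∈ I := by
        intro x hx
        by_contra hx'
        have : x ∈ ({x ∈ I | m x ∉ I} : Finset P) := mem_filter.2 ⟨hx, hx'⟩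
        exact (Finset.card_pos.2 ⟨x, this⟩).ne' hs0
      have hKt : #{x | a x ∈ W ∧ a (m x) ∉ W} ≤ t := by
        refine Finset.card_le_card_of_injOn (fun x => if x ∈ I then m x else x) ?_ ?_
        · intro x hx
          simp only [coe_filter, mem_univ, true_and, Set.mem_ofPred_eq] at hx ⊢
          by_cases hxI : x ∈ I
          · simp [hxI, hclosed x hxI, hx.2]
          · simp [hxI, hx.1]
        · intro x hx y hy hxy
          simp only [coe_filter, mem_univ, true_and, Set.mem_ofPred_eq] at hx hy
          dsimp only at hxy
          split_ifs at hxy with h1 h2 h2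
          · exact hm.injective hxy
          · exact absurd hy.1 (hxy ▸ hx.2)
          · exact absurd hx.1 (hxy ▸ hy.2)
          · exact hxy
      rw [hs0, add_zero] at hIs
      have hcW : Odd (c * #W) := by
        rw [Nat.odd_add'] at hpar; exact hpar.2 hIs
      obtain ⟨hco, hWo⟩ := Nat.odd_mul.1 hcW
      have hde : Even d := by rw [Nat.odd_add'] at hodd; exact hodd.1 hco
      have hto : Odd t := by
        have := hodd.mul hWo
        rw [Nat.even_iff] at *; rw [Nat.odd_iff] at *
        omega
      have := hK (hWpos hWo)
      have ht3 : 3 ≤ t := by rw [Nat.odd_iff] at hto; omega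
      have := Nat.mul_le_mul_left c ht3
      have := hd2 hde
      omega
    · rcases Nat.eq_zero_or_pos t with ht0 | ht0
      · have hIB : ∀ x, x ∈ I ↔ a x ∈ W := by
          intro x
          by_contra hx
          have : x ∈ ({x | ¬ (x ∈ I ↔ a x ∈ W)} : Finset P) := mem_filter.2 ⟨mem_univ _, hx⟩
          exact (Finset.card_pos.2 ⟨x, this⟩).ne' ht0
        have hKs : s = #{x | a x ∈ W ∧ a (m x) ∉ W} := by
          rw [hs]; congr 1; ext x; simp [hIB]
        have hWo : Odd #W := by
          rw [ht0, add_zero, ← Nat.not_odd_iff_even] at hIt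
          by_contra hWe
          rw [Nat.not_odd_iff_even] at hWe
          have h1 := hWe.mul_left c
          have h2 := hWe.mul_left (d + c)
          rw [Nat.odd_iff] at *; rw [Nat.even_iff] at *; omega
        have h2 := hodd.mul hWo
        have hso : Odd s := by
          rw [Nat.odd_iff] at *; rw [Nat.even_iff] at *; omega
        have hcW : Even (c * #W) := by
          rw [Nat.odd_iff] at hpar h2; rw [Nat.even_iff] at *; omega
        have hce : Even c := by
          rcases Nat.even_mul.1 hcW with h | h
          · exact h
          · exact absurd hWo (Nat.not_odd_iff_even.2 h)
        have hdo : Odd d := by rw [Nat.odd_add] at hodd; exact hodd.2 hce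
        have := hK (hWpos hWo)
        have hs3 : 3 ≤ s := by rw [Nat.odd_iff] at hso; omega
        have := Nat.mul_le_mul_left d hs3
        have := hd1 hdo
        omega
      · have := Nat.mul_le_mul_left d hs0
        have := Nat.mul_le_mul_left c ht0
        omega

theorem eq_empty_or_univ_of_cutWeight_eq_zero
    (hdeg : ∀ v, #{x | a x = v} = d + c) (hd : 0 < d) (hc : 0 < c)
    (hconn : ∀ W : Finset X, W.Nonempty → W ≠ univ → 2 ≤ #{x | a x ∈ W ∧ a (m x) ∉ W})
    (hj : ∀ v, j v ≤ c) (h0 : cutWeight a m c d I j = 0) :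
    (I = ∅ ∧ ∀ v, j v = 0) ∨ (I = univ ∧ ∀ v, j v = c) := by
  unfold cutWeight at h0
  rw [Nat.add_eq_zero_iff, Finset.sum_eq_zero_iff] at h0
  obtain ⟨h1, h2⟩ := h0
  have hclosed : ∀ x ∈ I, m x ∈ I := by
    intro x hx
    by_contra hx'
    have : x ∈ ({x ∈ I | m x ∉ I} : Finset P) := mem_filter.2 ⟨hx, hx'⟩
    have := Finset.card_pos.2 ⟨x, this⟩
    exact (Nat.mul_pos hd this).ne' h1
  have hin : ∀ x ∈ I, j (a x) = c := by
    intro x hx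
    have h := h2 (a x) (mem_univ _)
    have : 0 < #{y ∈ I | a y = a x} := Finset.card_pos.2 ⟨x, by simp [hx]⟩
    have h3 := (Nat.mul_eq_zero.1 (Nat.add_eq_zero_iff.1 h).1).resolve_left this.ne'
    have := hj (a x)
    omega
  have hout : ∀ x, x ∉ I → j (a x) = 0 := by
    intro x hx
    have h := h2 (a x) (mem_univ _)
    have : 0 < #{y ∈ Iᶜ | a y = a x} := Finset.card_pos.2 ⟨x, by simp [hx]⟩
    exact (Nat.mul_eq_zero.1 (Nat.add_eq_zero_iff.1 h).2).resolve_right this.ne'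
  set W : Finset X := {v | j v = c} with hWdef
  have hIW : ∀ x, x ∈ I ↔ a x ∈ W := by
    intro x
    simp only [hWdef, mem_filter, mem_univ, true_and]
    refine ⟨hin x, fun h => ?_⟩
    by_contra hx
    have := hout x hx
    omega
  have hK : ({x | a x ∈ W ∧ a (m x) ∉ W} : Finset P) = ∅ := by
    ext x; simp only [mem_filter, mem_univ, true_and, notMem_empty, iff_false, not_and, not_not]
    intro hx
    rw [← hIW] at hx ⊢
    exact hclosed x hx
  have hsurj : ∀ v, ∃ x, a x = v := by
    intro v
    have : 0 < #{x | a x = v} := by rw [hdeg v]; omega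
    obtain ⟨x, hx⟩ := Finset.card_pos.1 this
    exact ⟨x, by simpa using hx⟩
  rcases W.eq_empty_or_nonempty with hWe | hWn
  · left
    refine ⟨?_, ?_⟩
    · ext x; simp [hIW, hWe]
    · intro v
      obtain ⟨x, rfl⟩ := hsurj v
      exact hout x (by simp [hIW, hWe])
  · right
    have hWu : W = univ := by
      by_contra hne
      have := hconn W hWn hne
      rw [hK] at this; simp at this
    refine ⟨?_, ?_⟩
    · ext x; simp [hIW, hWu]
    · intro v
      have : v ∈ W := hWu ▸ mem_univ v
      simpa [hWdef] using this

variable (a m) in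
/-- The relation generating `gadget`: a half-edge is related to its other half and to the `c` cores
at its vertex; the half-edges in `R` and the `n` spare vertices form a clique. -/
def gadgetRel (R : Finset P) {c n : ℕ} :
    P ⊕ (X × Fin c) ⊕ Fin n → P ⊕ (X × Fin c) ⊕ Fin n → Prop
  | .inl x, .inl y => m x = y ∨ (x ∈ R ∧ y ∈ R)
  | .inl x, .inr (.inl p) => a x = p.1
  | .inl x, .inr (.inr _) => x ∈ R
  | .inr (.inr _), .inr (.inr _) => True
  | _, _ => False

variable (a m) in
/-- A graph whose perfect matchings encode the `d`-factors of a `(d + c)`-regular graph given by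
half-edges: the half-edges that are not matched to cores are those in the factor. The half-edges in
`R` are free to be in the factor or not. -/
def gadget (R : Finset P) (c n : ℕ) : SimpleGraph (P ⊕ (X × Fin c) ⊕ Fin n) :=
  SimpleGraph.fromRel (gadgetRel a m R)

variable (a m) in
/-- Weights on the edges of `gadget`: `d` between the two halves of an edge and `1` between a
half-edge and a core. -/
def gadgetWeight {c n : ℕ} (d : ℕ) :
    P ⊕ (X × Fin c) ⊕ Fin n → P ⊕ (X × Fin c) ⊕ Fin n → ℕ
  | .inl x, .inl y => if m x = y ∧ x ≠ y then d else 0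
  | .inl x, .inr (.inl p) => if a x = p.1 then 1 else 0
  | .inr (.inl p), .inl x => if a x = p.1 then 1 else 0
  | _, _ => 0

omit [Fintype X] [Fintype P] in
theorem gadget_adj_of_gadgetWeight_ne_zero {R : Finset P} {n : ℕ}
    (x y : P ⊕ (X × Fin c) ⊕ Fin n) (h : gadgetWeight a m d x y ≠ 0) :
    (gadget a m R c n).Adj x y := by
  rcases x with x | x | x <;> rcases y with y | y | y <;>
    simp_all [gadget, gadgetRel, gadgetWeight]

theorem sum_gadgetWeight_le (hm : Function.Involutive m)
    (hdeg : ∀ v, #{x | a x = v} = d + c) {n : ℕ} (y : P ⊕ (X × Fin c) ⊕ Fin n) : ∑ x, gadgetWeight a m d x y ≤ d + c := by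
  rw [Fintype.sum_sum_type, Fintype.sum_sum_type]
  rcases y with y | y | y
  · simp only [gadgetWeight, Finset.sum_const_zero, add_zero]
    refine Nat.add_le_add ?_ ?_
    · calc _ ≤ ∑ x, if x = m y then d else 0 := by
            refine Finset.sum_le_sum fun x _ => ?_
            by_cases h : m x = y
            · have : x = m y := by rw [← h, hm x]
              simp only [this, if_true]; split_ifs <;> simp
            · simp [h]
        _ ≤ d := by simp
    · rw [Fintype.sum_prod_type, Finset.sum_comm]; simp
  · simp only [gadgetWeight, Finset.sum_const_zero, add_zero]
    rw [← hdeg y.1, Finset.card_filter]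
  · simp [gadgetWeight]

theorem sum_gadgetWeight_eq_cutWeight {n : ℕ} (C : Finset (P ⊕ (X × Fin c) ⊕ Fin n)) :
    ∑ x ∈ C, ∑ y ∈ Cᶜ, gadgetWeight a m d x y =
      cutWeight a m c d {x | .inl x ∈ C} fun v => #{i : Fin c | .inr (.inl (v, i)) ∈ C} := by
  have h1 : ∑ x ∈ C, ∑ y ∈ Cᶜ, gadgetWeight a m d x y =
      ∑ x, ∑ y, if x ∈ C ∧ y ∉ C then gadgetWeight a m d x y else 0 := by
    rw [← Finset.sum_subset (Finset.subset_univ C)]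
    · refine Finset.sum_congr rfl fun x hx => ?_
      rw [← Finset.sum_subset (Finset.subset_univ Cᶜ)]
      · refine Finset.sum_congr rfl fun y hy => ?_
        simp_all
      · intro y _ hy
        simp_all
    · intro x _ hx
      simp [hx]
  rw [h1]
  have hI : ∀ v, #{x ∈ ({x | Sum.inl x ∈ C} : Finset P) | a x = v} =
      ∑ x : P, if Sum.inl x ∈ C ∧ a x = v then 1 else 0 := by
    intro v; rw [Finset.filter_filter, Finset.card_filter]
  have hIc : ∀ v, #{x ∈ ({x | Sum.inl x ∈ C} : Finset P)ᶜ | a x = v} =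
      ∑ x : P, if Sum.inl x ∉ C ∧ a x = v then 1 else 0 := by
    intro v
    rw [← Finset.card_filter]
    congr 1; ext x; simp
  have hJ : ∀ v, #{i : Fin c | Sum.inr (Sum.inl (v, i)) ∈ C} =
      ∑ i : Fin c, if Sum.inr (Sum.inl (v, i)) ∈ C then 1 else 0 := by
    intro v; rw [Finset.card_filter]
  have hJc : ∀ v, c - #{i : Fin c | Sum.inr (Sum.inl (v, i)) ∈ C} =
      ∑ i : Fin c, if Sum.inr (Sum.inl (v, i)) ∉ C then 1 else 0 := by
    intro v
    rw [← Finset.card_filter]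
    have := Finset.card_filter_add_card_filter_not (s := (univ : Finset (Fin c)))
      (fun i => Sum.inr (Sum.inl (v, i)) ∈ C)
    simp only [Finset.card_univ, Fintype.card_fin] at this
    omega
  unfold cutWeight
  simp only [hI, hIc, hJc, Fintype.sum_sum_type, gadgetWeight, ite_self, Finset.sum_const_zero,
    add_zero]
  rw [Finset.sum_add_distrib, Finset.sum_add_distrib, add_assoc]
  congr 1
  · rw [Finset.filter_filter, Finset.card_filter, Finset.mul_sum]
    refine Finset.sum_congr rfl fun x _ => ?_
    rw [Finset.sum_eq_single (m x)]
    · simp only [mem_filter, mem_univ, true_and, mul_ite, mul_one, mul_zero, ← ite_and]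
      congr 1
      refine propext ⟨fun h => h.1, fun h => ⟨h, fun e => h.2 (e ▸ h.1)⟩⟩
    · intro y _ hy
      simp [hy.symm]
    · simp
  · congr 1
    · simp only [Finset.sum_mul_sum]
      refine Finset.sum_comm.trans ?_
      simp only [Fintype.sum_prod_type]
      rw [Finset.sum_congr rfl fun v _ => Finset.sum_comm]
      refine Finset.sum_congr rfl fun v _ => Finset.sum_congr rfl fun x _ =>
        Finset.sum_congr rfl fun i _ => ?_
      by_cases h1 : a x = v <;> by_cases h2 : Sum.inl x ∈ C <;>
        by_cases h3 : Sum.inr (Sum.inl (v, i)) ∈ C <;> simp [h1, h2, h3]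
    · simp only [hJ, Finset.sum_mul_sum, Fintype.sum_prod_type]
      refine Finset.sum_congr rfl fun v _ => Finset.sum_congr rfl fun i _ =>
        Finset.sum_congr rfl fun x _ => ?_
      by_cases h1 : a x = v <;> by_cases h2 : Sum.inl x ∈ C <;>
        by_cases h3 : Sum.inr (Sum.inl (v, i)) ∈ C <;> simp [h1, h2, h3]

theorem exists_isPerfectMatching_gadget (hm : Function.Involutive m)
    (hdeg : ∀ v, #{x | a x = v} = d + c) (hd : 0 < d) (hc : 0 < c) (hodd : Odd (d + c))
    (hd1 : Odd d → d + c ≤ 3 * d) (hd2 : Even d → d + c ≤ 3 * c)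
    (hconn : ∀ W : Finset X, W.Nonempty → W ≠ univ → 2 ≤ #{x | a x ∈ W ∧ a (m x) ∉ W})
    {R : Finset P} (hp : ∀ x y, m x = x → m y = y → x ∉ R → y ∉ R → x = y) {n : ℕ}
    (hn : 0 < n → R.Nonempty)
    (hpar : Even (Fintype.card (P ⊕ (X × Fin c) ⊕ Fin n))) :
    ∃ M : (gadget a m R c n).Subgraph, M.IsPerfectMatching := by
  classical
  by_contra hno
  obtain ⟨𝒞, hcard, hsum, hCodd, hsep⟩ := (gadget a m R c n).exists_odd_family_of_weight hpar hno
    (gadgetWeight a m d) (d + c) gadget_adj_of_gadgetWeight_ne_zero (sum_gadgetWeight_le hm hdeg)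
  set cut : Finset (P ⊕ (X × Fin c) ⊕ Fin n) → ℕ :=
    fun C => ∑ x ∈ C, ∑ y ∈ Cᶜ, gadgetWeight a m d x y with hcut
  change ∑ C ∈ 𝒞, cut C + _ ≤ _ at hsum
  have hjle : ∀ (C : Finset (P ⊕ (X × Fin c) ⊕ Fin n)) v,
      #{i : Fin c | Sum.inr (Sum.inl (v, i)) ∈ C} ≤ c := fun C v =>
    (Finset.card_le_univ _).trans (by simp)
  have hjc : ∀ (C : Finset (P ⊕ (X × Fin c) ⊕ Fin n)) v,
      #{i : Fin c | Sum.inr (Sum.inl (v, i)) ∈ C} = c → ∀ i, Sum.inr (Sum.inl (v, i)) ∈ C := by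
    intro C v h i
    have : ({i : Fin c | Sum.inr (Sum.inl (v, i)) ∈ C} : Finset (Fin c)) = univ :=
      (Finset.card_eq_iff_eq_univ _).1 (by simpa using h)
    have := this ▸ mem_univ i
    simpa using this
  have hne : ∀ C ∈ 𝒞, ∃ C' ∈ 𝒞, C' ≠ C := fun C _ => Finset.exists_mem_ne (by omega) C
  have hspare : ∀ C ∈ 𝒞, ∀ C' ∈ 𝒞, C' ≠ C →
      (∀ v, #{i : Fin c | Sum.inr (Sum.inl (v, i)) ∈ C} = c) → ∃ i, Sum.inr (Sum.inr i) ∈ C' := by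
    intro C hC C' hC' hCC h
    obtain ⟨z, hz⟩ := Finset.card_pos.1 (hCodd C' hC').pos
    rcases z with x | ⟨v, i⟩ | i
    · have := (hsep C' hC' C hC hCC _ hz _ (hjc C _ (h (a x)) ⟨0, hc⟩)).2
      simp [gadget, gadgetRel] at this
    · exact absurd rfl (hsep C' hC' C hC hCC _ hz _ (hjc C _ (h v) i)).1
    · exact ⟨i, hz⟩
  have hcut0 : ∀ C ∈ 𝒞, (∃ x, Sum.inl x ∈ C) ∨
      (∀ v, #{i : Fin c | Sum.inr (Sum.inl (v, i)) ∈ C} = c) → cut C = 0 →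
      (∀ x, Sum.inl x ∈ C) ∧ ∀ v, #{i : Fin c | Sum.inr (Sum.inl (v, i)) ∈ C} = c := by
    intro C hC h h0
    simp only [hcut] at h0
    rw [sum_gadgetWeight_eq_cutWeight] at h0
    rcases eq_empty_or_univ_of_cutWeight_eq_zero hdeg hd hc hconn (hjle C) h0 with h1 | h1
    · rcases h with ⟨x, hx⟩ | h
      · have : x ∈ ({x | Sum.inl x ∈ C} : Finset P) := by simpa using hx
        rw [h1.1] at this; simp at this
      · refine ⟨fun x => ?_, h⟩
        have := h (a x)
        have := h1.2 (a x)
        omega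
    · refine ⟨fun x => ?_, h1.2⟩
      have : x ∈ ({x | Sum.inl x ∈ C} : Finset P) := by rw [h1.1]; exact mem_univ x
      simpa using this
  let K : Finset (P ⊕ (X × Fin c) ⊕ Fin n) → Prop := fun C =>
    (∃ x ∈ R, Sum.inl x ∈ C) ∨ ∃ i, Sum.inr (Sum.inr i) ∈ C
  let Q : Finset (P ⊕ (X × Fin c) ⊕ Fin n) → Prop := fun C =>
    ∃ x, x ∉ R ∧ m x = x ∧ Sum.inl x ∈ C
  have hK : ∀ C ∈ 𝒞, ∀ C' ∈ 𝒞, K C → K C' → C = C' := by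
    intro C hC C' hC' h h'
    by_contra hCC
    rcases h with ⟨x, hx, hxC⟩ | ⟨i, hi⟩ <;> rcases h' with ⟨y, hy, hyC⟩ | ⟨k, hk⟩
    · obtain ⟨h1, h2⟩ := hsep C hC C' hC' hCC _ hxC _ hyC
      exact h2 ((SimpleGraph.fromRel_adj _ _ _).2 ⟨h1, .inl (.inr ⟨hx, hy⟩)⟩)
    · obtain ⟨h1, h2⟩ := hsep C hC C' hC' hCC _ hxC _ hk
      exact h2 ((SimpleGraph.fromRel_adj _ _ _).2 ⟨h1, .inl hx⟩)
    · obtain ⟨h1, h2⟩ := hsep C hC C' hC' hCC _ hi _ hyC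
      exact h2 ((SimpleGraph.fromRel_adj _ _ _).2 ⟨h1, .inr hy⟩)
    · obtain ⟨h1, h2⟩ := hsep C hC C' hC' hCC _ hi _ hk
      exact h2 ((SimpleGraph.fromRel_adj _ _ _).2 ⟨h1, .inl trivial⟩)
  have hQ : ∀ C ∈ 𝒞, ∀ C' ∈ 𝒞, Q C → Q C' → C = C' := by
    rintro C hC C' hC' ⟨x, hxR, hx, hxC⟩ ⟨y, hyR, hy, hyC⟩
    by_contra hCC
    exact (hsep C hC C' hC' hCC _ hxC _ (hp x y hx hy hxR hyR ▸ hyC)).1 rfl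
  have hpos : ∀ C ∈ 𝒞, Q C → 0 < cut C := by
    rintro C hC ⟨x, -, -, hx⟩
    by_contra h0
    obtain ⟨h1, h2⟩ := hcut0 C hC (.inl ⟨x, hx⟩) (by omega)
    obtain ⟨C', hC', hCC⟩ := hne C hC
    obtain ⟨i, hi⟩ := hspare C hC C' hC' hCC h2
    obtain ⟨y, hy⟩ := hn i.pos
    exact hCC (hK C' hC' C hC (.inr ⟨i, hi⟩) (.inl ⟨y, hy, h1 y⟩))
  have hgood : ∀ C ∈ 𝒞, ¬ K C → ¬ Q C → d + c ≤ cut C := by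
    intro C hC hKC hQC
    simp only [K, not_or, not_exists, not_and] at hKC
    simp only [Q, not_exists, not_and] at hQC
    have hj : ∃ v, #{i : Fin c | Sum.inr (Sum.inl (v, i)) ∈ C} ≠ c := by
      by_contra! h
      obtain ⟨C', hC', hCC⟩ := hne C hC
      have h𝒞 : 𝒞 ⊆ {C, C'} := by
        intro D hD
        rw [mem_insert, mem_singleton]
        by_contra! hDC
        exact hDC.2 (hK D hD C' hC' (.inr (hspare C hC D hD hDC.1 h))
          (.inr (hspare C hC C' hC' hCC h)))
      have h2 : #𝒞 ≤ 2 := (Finset.card_le_card h𝒞).trans Finset.card_le_two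
      have h2 : #𝒞 = 2 := by omega
      rw [h2] at hsum
      have h3 : cut C ≤ ∑ C ∈ 𝒞, cut C := Finset.single_le_sum (fun _ _ => Nat.zero_le _) hC
      obtain ⟨h4, -⟩ := hcut0 C hC (.inr h) (by omega)
      obtain ⟨i, hi⟩ := hspare C hC C' hC' hCC h
      obtain ⟨y, hy⟩ := hn i.pos
      exact hKC.1 y hy (h4 y)
    have h := hCodd C hC
    rw [show #C = #{x : P | Sum.inl x ∈ C} + ∑ v, #{i : Fin c | Sum.inr (Sum.inl (v, i)) ∈ C} by
      have : #C = ∑ z, if z ∈ C then 1 else 0 := by simp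
      rw [this, Fintype.sum_sum_type, Fintype.sum_sum_type, Fintype.sum_prod_type]
      simp only [Finset.card_filter]
      simp [hKC.2]] at h
    simp only [hcut]
    rw [sum_gadgetWeight_eq_cutWeight]
    refine le_cutWeight hm hdeg hodd hd1 hd2 hconn (hjle C) hj ?_ h
    intro x hx hmx
    have hx : Sum.inl x ∈ C := by simpa using hx
    by_cases hxR : x ∈ R
    · exact hKC.1 x hxR hx
    · exact hQC x hxR hmx hx
  have hKcard : #{C ∈ 𝒞 | K C} ≤ 1 := Finset.card_le_one.2 fun C hC C' hC' => by
    simp only [mem_filter] at hC hC'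
    exact hK C hC.1 C' hC'.1 hC.2 hC'.2
  have hQcard : #{C ∈ 𝒞 | Q C} ≤ 1 := Finset.card_le_one.2 fun C hC C' hC' => by
    simp only [mem_filter] at hC hC'
    exact hQ C hC.1 C' hC'.1 hC.2 hC'.2
  have hall : ∑ C ∈ 𝒞, (d + c) ≤
      ∑ C ∈ 𝒞, (cut C + (if K C then d + c else 0) + if Q C then d + c - 1 else 0) := by
    refine Finset.sum_le_sum fun C hC => ?_
    by_cases h1 : K C <;> by_cases h2 : Q C
    · simp [h1]; omega
    · simp only [h1, h2, if_true, if_false]; omega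
    · have := hpos C hC h2
      simp only [h1, h2, if_true, if_false]; omega
    · simpa [h1, h2] using hgood C hC h1 h2
  rw [Finset.sum_const, Finset.sum_add_distrib, Finset.sum_add_distrib, ← Finset.sum_filter,
    ← Finset.sum_filter, Finset.sum_const, Finset.sum_const, smul_eq_mul, smul_eq_mul,
    smul_eq_mul] at hall
  have h1 := Nat.mul_le_mul_right (d + c) hKcard
  have h2 := Nat.mul_le_mul_right (d + c - 1) hQcard
  omega

/-- A connected bridgeless `(d + c)`-regular graph of odd degree, given by half-edges, has a
`d`-factor under the stated parity conditions; among the edges leaving the graph it only uses those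
in `R`, which are all but at most one. -/
theorem exists_factor_of_halfEdges (hm : Function.Involutive m)
    (hdeg : ∀ v, #{x | a x = v} = d + c) (hd : 0 < d) (hc : 0 < c) (hodd : Odd (d + c))
    (hd1 : Odd d → d + c ≤ 3 * d) (hd2 : Even d → d + c ≤ 3 * c)
    (hconn : ∀ W : Finset X, W.Nonempty → W ≠ univ → 2 ≤ #{x | a x ∈ W ∧ a (m x) ∉ W})
    {R : Finset P} (hR : ∀ x ∈ R, m x = x)
    (hp : ∀ x y, m x = x → m y = y → x ∉ R → y ∉ R → x = y)
    (hpar : Even (d * Fintype.card X) ∨ R.Nonempty) :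
    ∃ M : Finset P, (∀ x ∈ M, m x ∈ M) ∧ (∀ v, #{x ∈ M | a x = v} = d) ∧
      ∀ x ∈ M, m x = x → x ∈ R := by
  classical
  have hP : Fintype.card P = Fintype.card X * (d + c) := by
    rw [← Finset.card_univ (α := P),
      Finset.card_eq_sum_card_fiberwise (f := a) (t := univ) (fun _ _ => by simp)]
    simp [hdeg]
  set n := (d * Fintype.card X) % 2 with hn
  obtain ⟨N, hN⟩ := exists_isPerfectMatching_gadget hm hdeg hd hc hodd hd1 hd2 hconn hp (n := n)
    (by
      intro h
      refine hpar.resolve_left fun he => ?_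
      rw [Nat.even_iff] at he; omega)
    (by
      simp only [Fintype.card_sum, Fintype.card_prod, Fintype.card_fin, hP]
      rw [show Fintype.card X * (d + c) + (Fintype.card X * c + n) =
        d * Fintype.card X + n + 2 * (Fintype.card X * c) by ring, Nat.even_iff]
      omega)
  rw [SimpleGraph.Subgraph.isPerfectMatching_iff] at hN
  let M : Finset P := {x | ∀ p, ¬ N.Adj (.inl x) (.inr (.inl p))}
  have hM : ∀ x, x ∈ M ↔ ∀ p, ¬ N.Adj (.inl x) (.inr (.inl p)) := fun x => by simp [M]
  have hadj : ∀ x p, N.Adj (.inl x) (.inr (.inl p)) → a x = p.1 := by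
    intro x p h
    simpa [gadget, gadgetRel] using h.adj_sub
  refine ⟨M, ?_, ?_, ?_⟩
  · intro x hx
    rw [hM] at hx ⊢
    by_cases hmx : m x = x
    · rwa [hmx]
    have hxR : x ∉ R := fun h => hmx (hR x h)
    obtain ⟨z, hz, -⟩ := hN (.inl x)
    have hzz := hz.adj_sub
    rcases z with y | p | i
    · have hyx : y = m x := by
        simp only [gadget, gadgetRel, SimpleGraph.fromRel_adj, hxR, false_and, and_false,
          or_false] at hzz
        rcases hzz.2 with h | h
        · exact h.symm
        · rw [← h, hm y]
      subst hyx
      intro p hp'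
      have := (hN (.inl (m x))).unique hp' hz.symm
      simp at this
    · exact absurd hz (hx p)
    · simp [gadget, gadgetRel, hxR] at hzz
  · intro v
    have hg : ∀ i : Fin c, ∃ x, N.Adj (.inl x) (.inr (.inl (v, i))) := by
      intro i
      obtain ⟨z, hz, -⟩ := hN (.inr (.inl (v, i)))
      have hzz := hz.adj_sub
      rcases z with y | p | k
      · exact ⟨y, hz.symm⟩
      · simp [gadget, gadgetRel] at hzz
      · simp [gadget, gadgetRel] at hzz
    choose g hg using hg
    have hinj : Function.Injective g := by
      intro i k h
      have h1 := (hN (.inl (g i))).unique (hg i) (h ▸ hg k)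
      simpa using h1
    have himg : ({x ∈ Mᶜ | a x = v} : Finset P) = univ.image g := by
      ext x
      simp only [mem_filter, mem_compl, hM, mem_image, mem_univ, true_and]
      push Not
      constructor
      · rintro ⟨⟨⟨w, i⟩, hp'⟩, rfl⟩
        have : a x = w := hadj x _ hp'
        subst this
        refine ⟨i, ?_⟩
        have := (hN (.inr (.inl (a x, i)))).unique (hg i).symm hp'.symm
        simpa using this
      · rintro ⟨i, rfl⟩
        exact ⟨⟨_, hg i⟩, hadj _ _ (hg i)⟩
    have h1 : #{x ∈ Mᶜ | a x = v} = c := by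
      rw [himg, Finset.card_image_of_injective _ hinj]; simp
    have h2 := card_fiber_inter_add (I := M) hdeg v
    omega
  · intro x hx hmx
    rw [hM] at hx
    by_contra hxR
    obtain ⟨z, hz, -⟩ := hN (.inl x)
    have hzz := hz.adj_sub
    rcases z with y | p | i
    · simp only [gadget, gadgetRel, SimpleGraph.fromRel_adj, hxR, false_and, and_false,
          or_false] at hzz
      rcases hzz.2 with h | h
      · exact hzz.1 (by rw [← h, hmx])
      · exact hzz.1 (by rw [← hmx, ← h, hm y])
    · exact hx p hz
    · simp [gadget, gadgetRel, hxR] at hzz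

end

namespace Multigraph

variable {V E : Type*} [Fintype V] [Fintype E] [DecidableEq V] (G : Multigraph V E)

open Classical in
/-- The edges in `A` with an end in `S` and an end in `S'`. -/
noncomputable def between (A : Finset E) (S S' : Finset V) : Finset E :=
  {e ∈ A | (∃ v ∈ S, v ∈ G.ends e) ∧ ∃ w ∈ S', w ∈ G.ends e}

omit [Fintype V] [Fintype E] in
theorem mem_between {A : Finset E} {S S' : Finset V} {e : E} :
    e ∈ G.between A S S' ↔ e ∈ A ∧ (∃ v ∈ S, v ∈ G.ends e) ∧ ∃ w ∈ S', w ∈ G.ends e := by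
  simp [between]

/-- If all vertices of `S` have degree `d + c` in `A` and `S` is connected without bridges, then
some `F ⊆ A` avoiding `T` has degree `d` at every vertex of `S`. -/
theorem exists_factor_of_two_le_between {d c : ℕ} {S : Finset V} {A T : Finset E}
    (hreg : ∀ v ∈ S, G.degIn A v = d + c) (hd : 0 < d) (hc : 0 < c) (hodd : Odd (d + c))
    (hd1 : Odd d → d + c ≤ 3 * d) (hd2 : Even d → d + c ≤ 3 * c)
    (hconn : ∀ W ⊆ S, W.Nonempty → W ≠ S → 2 ≤ #(G.between A W (S \ W)))
    (hT : #T ≤ 1) (hTS : ∀ e ∈ T, ∃ w ∉ S, w ∈ G.ends e)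
    (hpar : Even (d * #S) ∨ ∃ e ∈ A, e ∉ T ∧ (∃ v ∈ S, v ∈ G.ends e) ∧ ∃ w ∉ S, w ∈ G.ends e) :
    ∃ F ⊆ A, (∀ v ∈ S, G.degIn F v = d) ∧ ∀ e ∈ T, e ∉ F := by
  classical
  let P := {x : V × E // x.1 ∈ S ∧ x.2 ∈ A ∧ x.1 ∈ G.ends x.2}
  let a : P → S := fun x => ⟨x.1.1, x.2.1⟩
  let ed : P → E := fun x => x.1.2
  have hext : ∀ x y : P, a x = a y → ed x = ed y → x = y := by
    intro x y h1 h2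
    exact Subtype.ext (Prod.ext (congrArg Subtype.val h1) h2)
  have hends : ∀ x : P, (a x : V) ∈ G.ends (ed x) := fun x => x.2.2.2
  have two_ends : ∀ e u v w, u ∈ G.ends e → v ∈ G.ends e → w ∈ G.ends e →
      u ≠ v → u ≠ w → v = w := by
    intro e u v w
    induction G.ends e with
    | _ p q =>
      simp only [Sym2.mem_iff]
      rintro (rfl | rfl) (rfl | rfl) (rfl | rfl) <;> simp
  have htwo : ∀ x y z : P, ed x = ed y → ed x = ed z → x ≠ y → x ≠ z → y = z := by
    intro x y z hy hz hxy hxz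
    refine hext y z (Subtype.ext (two_ends (ed x) (a x) _ _ (hends x) (hy ▸ hends y)
      (hz ▸ hends z) (fun h => hxy ?_) (fun h => hxz ?_))) (hy.symm.trans hz)
    · exact hext _ _ (Subtype.ext h) hy
    · exact hext _ _ (Subtype.ext h) hz
  let m : P → P := fun x => if h : ∃ y, y ≠ x ∧ ed y = ed x then h.choose else x
  have hmed : ∀ x, ed (m x) = ed x := by
    intro x
    simp only [m]
    split_ifs with h
    · exact h.choose_spec.2
    · rfl
  have hmne : ∀ x y, y ≠ x → ed y = ed x → m x = y := by
    intro x y hy hed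
    have h : ∃ y, y ≠ x ∧ ed y = ed x := ⟨y, hy, hed⟩
    have hmx : m x = h.choose := dif_pos h
    rw [hmx]
    exact htwo x _ _ h.choose_spec.2.symm hed.symm h.choose_spec.1.symm hy.symm
  have hm : Function.Involutive m := by
    intro x
    by_cases hx : m x = x
    · rw [hx, hx]
    · exact hmne _ _ (Ne.symm hx) (hmed x).symm
  have hcount : ∀ (Q : Finset P) (F : Finset E) (v : S),
      (∀ e, (e ∈ F ∧ (v : V) ∈ G.ends e) ↔ ∃ x ∈ Q, a x = v ∧ ed x = e) →
      #{x ∈ Q | a x = v} = G.degIn F v := by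
    intro Q F v h
    unfold degIn
    rw [← Finset.card_image_of_injOn (f := ed) (s := {x ∈ Q | a x = v})]
    · congr 1
      ext e
      rw [mem_filter, h e]
      simp [and_assoc]
    · intro x hx y hy hxy
      simp only [coe_filter, Set.mem_ofPred_eq] at hx hy
      exact hext _ _ (hx.2.trans hy.2.symm) hxy
  have hdeg : ∀ v, #{x | a x = v} = d + c := by
    intro v
    rw [← hreg v v.2]
    refine hcount _ _ _ fun e => ⟨fun h => ?_, ?_⟩
    · exact ⟨⟨(v, e), v.2, h.1, h.2⟩, mem_univ _, rfl, rfl⟩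
    · rintro ⟨x, -, rfl, rfl⟩
      exact ⟨x.2.2.1, hends x⟩
  have hconn' : ∀ W : Finset S, W.Nonempty → W ≠ univ → 2 ≤ #{x | a x ∈ W ∧ a (m x) ∉ W} := by
    intro W hWn hWu
    have h := hconn (W.map (Function.Embedding.subtype _)) (fun v hv => by
      obtain ⟨w, -, rfl⟩ := Finset.mem_map.1 hv; exact w.2) (hWn.map) (by
      intro h
      refine hWu (Finset.eq_univ_of_forall fun v => ?_)
      have : (v : V) ∈ W.map (Function.Embedding.subtype _) := by rw [h]; exact v.2
      simpa using this)
    refine h.trans ((Finset.card_le_card (t := image ed {x | a x ∈ W ∧ a (m x) ∉ W}) ?_).trans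
      Finset.card_image_le)
    intro e he
    obtain ⟨heA, ⟨v, hv, hve⟩, w, hw, hwe⟩ := (G.mem_between).1 he
    obtain ⟨v, hvW, rfl⟩ := Finset.mem_map.1 hv
    obtain ⟨hwS, hw⟩ := Finset.mem_sdiff.1 hw
    have hwW : (⟨w, hwS⟩ : S) ∉ W := fun h => hw (Finset.mem_map.2 ⟨_, h, rfl⟩)
    let x : P := ⟨(v, e), v.2, heA, hve⟩
    let y : P := ⟨(w, e), hwS, heA, hwe⟩
    have hyx : y ≠ x := by
      intro h
      have h' : a y = a x := by rw [h]
      exact hwW (h' ▸ hvW : a y ∈ W)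
    refine Finset.mem_image.2 ⟨x, ?_, rfl⟩
    rw [mem_filter, hmne x y hyx rfl]
    exact ⟨mem_univ _, hvW, hwW⟩
  have hfix : ∀ x, (∃ w ∉ S, w ∈ G.ends (ed x)) → m x = x := by
    rintro x ⟨w, hwS, hw⟩
    by_contra h
    refine hwS (two_ends (ed x) (a x) (a (m x)) w (hends x) (hmed x ▸ hends (m x)) hw ?_ ?_ ▸
      (a (m x)).2)
    · intro h'
      exact h (hext _ _ (Subtype.ext h'.symm) (hmed x))
    · rintro h'
      exact hwS (h' ▸ (a x).2)
  let R : Finset P := {x | m x = x ∧ ed x ∉ T}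
  have hp : ∀ x y, m x = x → m y = y → x ∉ R → y ∉ R → x = y := by
    intro x y hx hy hxR hyR
    simp only [R, mem_filter, mem_univ, true_and, not_and, not_not] at hxR hyR
    have he : ed x = ed y := Finset.card_le_one.1 hT _ (hxR hx) _ (hyR hy)
    by_contra hxy
    exact hxy (hx.symm.trans (hmne x y (Ne.symm hxy) he.symm))
  obtain ⟨M, hM1, hM2, hM3⟩ := exists_factor_of_halfEdges hm hdeg hd hc hodd hd1 hd2 hconn'
    (R := R) (fun x hx => (mem_filter.1 hx).2.1) hp (by
      rw [Fintype.card_coe]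
      refine hpar.imp_right ?_
      rintro ⟨e, heA, heT, ⟨v, hvS, hv⟩, hw⟩
      refine ⟨⟨(v, e), hvS, heA, hv⟩, mem_filter.2 ⟨mem_univ _, hfix _ hw, heT⟩⟩)
  refine ⟨M.image ed, ?_, ?_, ?_⟩
  · intro e he
    obtain ⟨x, -, rfl⟩ := Finset.mem_image.1 he
    exact x.2.2.1
  · intro v hv
    rw [← hM2 ⟨v, hv⟩]
    refine (hcount _ _ ⟨v, hv⟩ fun e => ⟨?_, ?_⟩).symm
    · rintro ⟨he, hve⟩
      obtain ⟨x, hx, rfl⟩ := Finset.mem_image.1 he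
      let y : P := ⟨(v, ed x), hv, x.2.2.1, hve⟩
      by_cases hxy : y = x
      · exact ⟨x, hx, congrArg a hxy.symm, rfl⟩
      · have := hmne x y hxy rfl
        exact ⟨m x, hM1 x hx, congrArg a this, hmed x⟩
    · rintro ⟨x, hx, hxv, rfl⟩
      exact ⟨Finset.mem_image_of_mem _ hx, by have := hends x; rwa [hxv] at this⟩
  · intro e heT he
    obtain ⟨x, hx, rfl⟩ := Finset.mem_image.1 he
    have := hM3 x hx (hfix x (hTS _ heT))
    exact (mem_filter.1 this).2.2 heT

omit [Fintype V] in
theorem degIn_congr {F F' : Finset E} {v : V} (h : ∀ e, v ∈ G.ends e → (e ∈ F ↔ e ∈ F')) :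
    G.degIn F v = G.degIn F' v := by
  unfold degIn
  congr 1
  ext e
  simp only [mem_filter]
  exact ⟨fun ⟨h1, h2⟩ => ⟨(h e h2).1 h1, h2⟩, fun ⟨h1, h2⟩ => ⟨(h e h2).2 h1, h2⟩⟩

omit [Fintype V] in
theorem degIn_sdiff_add [DecidableEq E] {A F : Finset E} (hF : F ⊆ A) (v : V) :
    G.degIn (A \ F) v + G.degIn F v = G.degIn A v := by
  unfold degIn
  rw [← Finset.card_union_of_disjoint, ← Finset.filter_union, Finset.sdiff_union_of_subset hF]
  exact Finset.disjoint_filter_filter Finset.sdiff_disjoint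

/-- All vertices of `S` have degree `d` or `d'` in `F`, the edges of `F` inside `S` join vertices of
equal degree, and the edges of `F` leaving `S` do so from vertices of degree `d`. -/
structure IsLocallyRegularOn (S : Finset V) (d d' : ℕ) (F : Finset E) : Prop where
  degIn_eq : ∀ v ∈ S, G.degIn F v = d ∨ G.degIn F v = d'
  degIn_eq_degIn : ∀ e ∈ F, ∀ v ∈ S, ∀ w ∈ S, v ∈ G.ends e → w ∈ G.ends e →
    G.degIn F v = G.degIn F w
  degIn_eq_of_notMem : ∀ e ∈ F, ∀ v ∈ S, ∀ w ∉ S, v ∈ G.ends e → w ∈ G.ends e → G.degIn F v = d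

variable {G}

omit [Fintype V] in
theorem IsLocallyRegularOn.of_forall_degIn_eq {S : Finset V} {d d' : ℕ} {F : Finset E}
    (h : ∀ v ∈ S, G.degIn F v = d) : G.IsLocallyRegularOn S d d' F :=
  ⟨fun v hv => .inl (h v hv), fun _ _ v hv w hw _ _ => (h v hv).trans (h w hw).symm,
    fun _ _ v hv _ _ _ _ => h v hv⟩

omit [Fintype V] in
theorem IsLocallyRegularOn.union {S₁ S₂ : Finset V} {d d' : ℕ} {A F₁ F₂ : Finset E}
    (h₁ : G.IsLocallyRegularOn S₁ d d' F₁) (h₂ : G.IsLocallyRegularOn S₂ d d' F₂)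
    (hA₁ : F₁ ⊆ A) (hA₂ : F₂ ⊆ A) (hdisj : Disjoint S₁ S₂)
    (hagree : ∀ e ∈ G.between A S₁ S₂, e ∈ F₁ ↔ e ∈ F₂) :
    ∃ F ⊆ A, G.IsLocallyRegularOn (S₁ ∪ S₂) d d' F ∧
      ∀ e ∈ A, (∃ v ∈ S₁, v ∈ G.ends e) → (e ∈ F ↔ e ∈ F₁) := by
  classical
  let F : Finset E :=
    {e ∈ A | (e ∈ F₁ ∧ ∃ v ∈ S₁, v ∈ G.ends e) ∨ (e ∈ F₂ ∧ ∃ v ∈ S₂, v ∈ G.ends e)}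
  have hF₁ : ∀ e, (∃ v ∈ S₁, v ∈ G.ends e) → (e ∈ F ↔ e ∈ F₁) := by
    intro e hv
    simp only [F, mem_filter]
    constructor
    · rintro ⟨hA, h | h⟩
      · exact h.1
      · exact (hagree e (G.mem_between.2 ⟨hA, hv, h.2⟩)).2 h.1
    · exact fun h => ⟨hA₁ h, .inl ⟨h, hv⟩⟩
  have hF₂ : ∀ e, (∃ v ∈ S₂, v ∈ G.ends e) → (e ∈ F ↔ e ∈ F₂) := by
    intro e hv
    simp only [F, mem_filter]
    constructor
    · rintro ⟨hA, h | h⟩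
      · exact (hagree e (G.mem_between.2 ⟨hA, h.2, hv⟩)).1 h.1
      · exact h.1
    · exact fun h => ⟨hA₂ h, .inr ⟨h, hv⟩⟩
  have hd₁ : ∀ v ∈ S₁, G.degIn F v = G.degIn F₁ v := fun v hv =>
    G.degIn_congr fun e he => hF₁ e ⟨v, hv, he⟩
  have hd₂ : ∀ v ∈ S₂, G.degIn F v = G.degIn F₂ v := fun v hv =>
    G.degIn_congr fun e he => hF₂ e ⟨v, hv, he⟩
  have hcross : ∀ e ∈ F, ∀ v ∈ S₁, ∀ w ∈ S₂, v ∈ G.ends e → w ∈ G.ends e →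
      G.degIn F v = d ∧ G.degIn F w = d := by
    intro e he v hv w hw hve hwe
    rw [hd₁ v hv, hd₂ w hw]
    exact ⟨h₁.degIn_eq_of_notMem e ((hF₁ e ⟨v, hv, hve⟩).1 he) v hv w
        (Finset.disjoint_right.1 hdisj hw) hve hwe,
      h₂.degIn_eq_of_notMem e ((hF₂ e ⟨w, hw, hwe⟩).1 he) w hw v
        (Finset.disjoint_left.1 hdisj hv) hwe hve⟩
  refine ⟨F, Finset.filter_subset _ _, ⟨?_, ?_, ?_⟩, fun e _ => hF₁ e⟩
  · intro v hv
    rcases Finset.mem_union.1 hv with hv | hv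
    · rw [hd₁ v hv]; exact h₁.degIn_eq v hv
    · rw [hd₂ v hv]; exact h₂.degIn_eq v hv
  · intro e he v hv w hw hve hwe
    rcases Finset.mem_union.1 hv with hv | hv <;> rcases Finset.mem_union.1 hw with hw | hw
    · rw [hd₁ v hv, hd₁ w hw]
      exact h₁.degIn_eq_degIn e ((hF₁ e ⟨v, hv, hve⟩).1 he) v hv w hw hve hwe
    · have := hcross e he v hv w hw hve hwe
      rw [this.1, this.2]
    · have := hcross e he w hw v hv hwe hve
      rw [this.1, this.2]
    · rw [hd₂ v hv, hd₂ w hw]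
      exact h₂.degIn_eq_degIn e ((hF₂ e ⟨v, hv, hve⟩).1 he) v hv w hw hve hwe
  · intro e he v hv w hw hve hwe
    rw [Finset.mem_union, not_or] at hw
    rcases Finset.mem_union.1 hv with hv | hv
    · rw [hd₁ v hv]
      exact h₁.degIn_eq_of_notMem e ((hF₁ e ⟨v, hv, hve⟩).1 he) v hv w hw.1 hve hwe
    · rw [hd₂ v hv]
      exact h₂.degIn_eq_of_notMem e ((hF₂ e ⟨v, hv, hve⟩).1 he) v hv w hw.2 hve hwe

/-- The case of `exists_isLocallyRegularOn` in which `S` is connected without bridges and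
`r ≤ 3 * d`. -/
theorem exists_isLocallyRegularOn_of_two_le_between {d d' r : ℕ} {S : Finset V} {A T : Finset E}
    (hd : Odd d) (hd' : Even d') (hr : Odd r) (hdr : d < r) (h3 : r ≤ 3 * d)
    (hd'r : 3 * d' ≤ 2 * r) (hreg : ∀ v ∈ S, G.degIn A v = r)
    (hconn : ∀ W ⊆ S, W.Nonempty → W ≠ S → 2 ≤ #(G.between A W (S \ W)))
    (hT : #T ≤ 1) (hTA : T ⊆ A) (hTS : ∀ e ∈ T, ∃ w ∉ S, w ∈ G.ends e) (b : Prop) :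
    ∃ F ⊆ A, G.IsLocallyRegularOn S d d' F ∧ ∀ e ∈ T, e ∈ F ↔ b := by
  classical
  have hdpos := hd.pos
  obtain ⟨c, rfl⟩ := Nat.exists_eq_add_of_lt hdr
  rw [add_assoc] at *
  generalize hc' : c + 1 = c' at *
  have hc'e : Even c' := by rw [Nat.odd_add] at hr; exact hr.1 hd
  by_cases hb : b
  · obtain ⟨F, hFA, hF, hFT⟩ := G.exists_factor_of_two_le_between (d := c') (c := d) (T := T)
      (fun v hv => by rw [hreg v hv, add_comm]) (by omega) hdpos (by rwa [add_comm])
      (fun h => absurd hc'e (Nat.not_even_iff_odd.2 h)) (fun _ => by omega) hconn hT hTS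
      (.inl (hc'e.mul_right _))
    refine ⟨A \ F, Finset.sdiff_subset, .of_forall_degIn_eq fun v hv => ?_, fun e he => ?_⟩
    · have := G.degIn_sdiff_add hFA v
      rw [hF v hv, hreg v hv] at this
      omega
    · simp [hb, hFT e he, hTA he]
  · simp only [hb, iff_false]
    by_cases hfree : ∃ e ∈ A, e ∉ T ∧ (∃ v ∈ S, v ∈ G.ends e) ∧ ∃ w ∉ S, w ∈ G.ends e
    · obtain ⟨F, hFA, hF, hFT⟩ := G.exists_factor_of_two_le_between hreg hdpos (by omega) hr
        (fun _ => h3) (fun h => absurd hd (Nat.not_odd_iff_even.2 h)) hconn hT hTS (.inr hfree)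
      exact ⟨F, hFA, .of_forall_degIn_eq hF, hFT⟩
    · have hext : ∀ F ⊆ A, (∀ e ∈ T, e ∉ F) → (∀ v ∈ S, G.degIn F v = d') →
          G.IsLocallyRegularOn S d d' F := by
        intro F hFA hFT hF
        refine ⟨fun v hv => .inr (hF v hv), fun _ _ v hv w hw _ _ => (hF v hv).trans (hF w hw).symm,
          fun e he v hv w hw hve hwe => ?_⟩
        exact absurd ⟨e, hFA he, fun h => hFT e h he, ⟨v, hv, hve⟩, w, hw, hwe⟩ hfree
      rcases Nat.eq_zero_or_pos d' with rfl | hd'pos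
      · exact ⟨∅, by simp, hext ∅ (by simp) (by simp) (by simp [degIn]), by simp⟩
      · obtain ⟨c₂, hc₂⟩ := Nat.exists_eq_add_of_le (show d' ≤ d + c' by omega)
        obtain ⟨F, hFA, hF, hFT⟩ := G.exists_factor_of_two_le_between (d := d') (c := c₂) (T := T)
          (fun v hv => by rw [hreg v hv, hc₂]) hd'pos (by omega) (hc₂ ▸ hr)
          (fun h => absurd hd' (Nat.not_even_iff_odd.2 h)) (fun _ => by omega) hconn hT hTS
          (.inl (hd'.mul_right _))
        exact ⟨F, hFA, hext F hFA hFT hF, hFT⟩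

/-- A set `S` of vertices of odd degree `r` in `A` has a locally regular subset of `A` in which the
membership of at most one prescribed edge leaving `S` can be chosen freely. -/
theorem exists_isLocallyRegularOn {d d' : ℕ} (hd : Odd d) (hd' : Even d') (hdd : d' ≤ d + 1)
    (r : ℕ) (S : Finset V) (A T : Finset E)
    (hr : Odd r) (hdr : d < r) (hd'r : 3 * d' ≤ 2 * r) (hreg : ∀ v ∈ S, G.degIn A v = r)
    (hT : #T ≤ 1) (hTA : T ⊆ A) (hTS : ∀ e ∈ T, (∃ v ∈ S, v ∈ G.ends e) ∧ ∃ w ∉ S, w ∈ G.ends e)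
    (b : Prop) :
    ∃ F ⊆ A, G.IsLocallyRegularOn S d d' F ∧ ∀ e ∈ T, e ∈ F ↔ b := by
  classical
  induction hN : r + #S using Nat.strong_induction_on generalizing r S A T b with
  | _ N ih =>
  subst hN
  by_cases hconn : ∀ W ⊆ S, W.Nonempty → W ≠ S → 2 ≤ #(G.between A W (S \ W))
  · by_cases h3 : r ≤ 3 * d
    · exact exists_isLocallyRegularOn_of_two_le_between hd hd' hr hdr h3 hd'r hreg hconn hT hTA
        (fun e he => (hTS e he).2) b
    · have hr5 : 5 ≤ r ∧ 3 * d + 2 ≤ r := by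
        have := hd.pos
        rw [Nat.odd_iff] at hd hr; omega
      obtain ⟨c, rfl⟩ := Nat.exists_eq_add_of_le (show 2 ≤ r by omega)
      obtain ⟨D, hDA, hD, hDT⟩ := G.exists_factor_of_two_le_between hreg (by omega) (by omega) hr
        (fun h => absurd h (by decide)) (fun _ => by omega) hconn hT (fun e he => (hTS e he).2)
        (.inl (even_two.mul_right _))
      obtain ⟨F, hFA, hF, hFT⟩ := ih (c + #S) (by omega) c S (A \ D) T
        (by rw [Nat.odd_iff] at *; omega) (by omega) (by omega)
        (fun v hv => by
          have := G.degIn_sdiff_add hDA v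
          rw [hD v hv, hreg v hv] at this
          omega)
        hT (fun e he => Finset.mem_sdiff.2 ⟨hTA he, hDT e he⟩) hTS b rfl
      exact ⟨F, hFA.trans Finset.sdiff_subset, hF, hFT⟩
  · have hsplit : ∀ S₁ S₂, S₁ ∪ S₂ = S → Disjoint S₁ S₂ → S₁.Nonempty → S₂.Nonempty →
        #(G.between A S₁ S₂) ≤ 1 → (∀ e ∈ T, ∃ v ∈ S₁, v ∈ G.ends e) →
        ∃ F ⊆ A, G.IsLocallyRegularOn S d d' F ∧ ∀ e ∈ T, e ∈ F ↔ b := by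
      rintro S₁ S₂ rfl hdisj hn₁ hn₂ hcard hTS₁
      have hcardS := Finset.card_union_of_disjoint hdisj
      have := hn₁.card_pos
      have := hn₂.card_pos
      obtain ⟨F₁, hFA₁, hF₁, hFT₁⟩ := ih (r + #S₁) (by omega) r S₁ A T hr hdr hd'r
        (fun v hv => hreg v (Finset.mem_union_left _ hv)) hT hTA
        (fun e he => ⟨hTS₁ e he, by
          obtain ⟨w, hw, hwe⟩ := (hTS e he).2
          exact ⟨w, fun h => hw (Finset.mem_union_left _ h), hwe⟩⟩) b rfl
      obtain ⟨F₂, hFA₂, hF₂, hFT₂⟩ := ih (r + #S₂) (by omega) r S₂ A (G.between A S₁ S₂) hr hdr hd'r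
        (fun v hv => hreg v (Finset.mem_union_right _ hv)) hcard
        (fun e he => (G.mem_between.1 he).1)
        (fun e he => by
          obtain ⟨-, ⟨v, hv, hve⟩, w⟩ := G.mem_between.1 he
          exact ⟨w, v, Finset.disjoint_left.1 hdisj hv, hve⟩)
        (∃ e ∈ G.between A S₁ S₂, e ∈ F₁) rfl
      obtain ⟨F, hFA, hF, hFF⟩ := hF₁.union hF₂ hFA₁ hFA₂ hdisj (fun e he => by
        rw [hFT₂ e he]
        refine ⟨fun h => ⟨e, he, h⟩, ?_⟩
        rintro ⟨e', he', h⟩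
        rwa [Finset.card_le_one.1 hcard e he e' he'])
      exact ⟨F, hFA, hF, fun e he => (hFF e (hTA he) (hTS₁ e he)).trans (hFT₁ e he)⟩
    push Not at hconn
    obtain ⟨W, hWS, hWn, hWne, hW⟩ := hconn
    have hn₂ : (S \ W).Nonempty := Finset.sdiff_nonempty.2 fun h => hWne (hWS.antisymm h)
    by_cases hTW : ∀ e ∈ T, ∃ v ∈ W, v ∈ G.ends e
    · exact hsplit W (S \ W) (Finset.union_sdiff_of_subset hWS) Finset.disjoint_sdiff hWn hn₂
        (by omega) hTW
    · refine hsplit (S \ W) W (Finset.sdiff_union_of_subset hWS) Finset.sdiff_disjoint hn₂ hWn ?_ ?_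
      · rw [show G.between A (S \ W) W = G.between A W (S \ W) by
          ext e; simp only [mem_between]; tauto]
        omega
      · push Not at hTW
        obtain ⟨e, he, h⟩ := hTW
        intro e' he'
        rw [Finset.card_le_one.1 hT e' he' e he]
        obtain ⟨v, hv, hve⟩ := (hTS e he).1
        exact ⟨v, Finset.mem_sdiff.2 ⟨hv, fun hvW => h v hvW hve⟩, hve⟩

end Multigraph

/-- (Kano) Let `r ≥ 3` be odd and `1 ≤ k ≤ 2r/3`.  Every `r`-regular graph has a
`[k-1, k]`-factor (a spanning subgraph, given here by its edge set `F`) each of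
whose connected components is a regular graph. -/
theorem regular_graph_has_almost_regular_factor
    {V E : Type*} [Fintype V] [Fintype E] [DecidableEq V]
    (r : ℕ) (hr : 3 ≤ r) (hodd : Odd r) (k : ℕ) (hk1 : 1 ≤ k) (hk2 : 3 * k ≤ 2 * r)
    (G : Multigraph V E) (hreg : ∀ v, G.degree v = r) :
    ∃ F : Finset E,
      (∀ v, k - 1 ≤ G.degIn F v ∧ G.degIn F v ≤ k) ∧
      (∀ v w, (G.supportGraph ↑F).Reachable v w → G.degIn F v = G.degIn F w) := by
  classical
  obtain ⟨d, d', hd, hd', hdd, hmin, hmax⟩ : ∃ d d', Odd d ∧ Even d' ∧ d' ≤ d + 1 ∧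
      (k - 1 ≤ d ∧ d ≤ k) ∧ k - 1 ≤ d' ∧ d' ≤ k := by
    rcases Nat.even_or_odd k with h | h
    · exact ⟨k - 1, k, Nat.Even.sub_odd hk1 h odd_one, h, by omega, by omega, by omega⟩
    · exact ⟨k, k - 1, h, Nat.Odd.sub_odd h odd_one, by omega, by omega, by omega⟩
  obtain ⟨F, -, hF, -⟩ := Multigraph.exists_isLocallyRegularOn (G := G) hd hd' hdd r univ univ ∅
    hodd (by omega) (by omega) (fun v _ => hreg v) (by simp) (by simp) (by simp) True
  refine ⟨F, fun v => ?_, ?_⟩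
  · rcases hF.degIn_eq v (mem_univ v) with h | h <;> rw [h] <;> assumption
  · rintro v w ⟨p⟩
    induction p with
    | nil => rfl
    | cons h _ ih =>
      obtain ⟨-, e, he, hee⟩ := h
      refine (hF.degIn_eq_degIn e he _ (mem_univ _) _ (mem_univ _) ?_ ?_).trans ih <;> simp [hee]
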